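/- Let a > 0 be a real number, let t₀ be a natural number, and let v, n : ℕ → ℝ be sequences such that n_t > 0 for all t ≥ t₀, v_{t₀} ≤ 3a/n_{t₀}, and for every t > t₀ one has n_{t−1} ≥ (2/3)·n_t and v_t ≤ a/(2·n_t) + v_{t−1}/2. Then v_t ≤ 3a/n_t for every t ≥ t₀. -/

import Mathlib

/-- Induction step for the variance bound on the global estimator: if `v t₀ ≤ 3a / n t₀`,
the counts satisfy `n (t-1) ≥ (2/3) n t`, and `v t ≤ a/(2 n t) + v (t-1)/2` for `t > t₀`,
then `v t ≤ 3a / n t` for all `t ≥ t₀`. -/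
theorem variance_recursion_bound
    (a : ℝ) (ha : 0 < a) (t₀ : ℕ) (v n : ℕ → ℝ)
    (hn : ∀ t ≥ t₀, 0 < n t)
    (hbase : v t₀ ≤ 3 * a / n t₀)
    (hgrow : ∀ t > t₀, n (t - 1) ≥ (2 / 3) * n t)
    (hrec : ∀ t > t₀, v t ≤ a / (2 * n t) + v (t - 1) / 2) :
    ∀ t ≥ t₀, v t ≤ 3 * a / n t := by
  intro t ht
  induction t, ht using Nat.le_induction with
  | base => exact hbase
  | succ k hk ih =>
    have h1 := hgrow (k + 1) (by omega)
    have h2 := hrec (k + 1) (by omega)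
    have hp := hn (k + 1) (by omega)
    rw [Nat.add_sub_cancel] at h1 h2
    have h3 : 3 * a / n k ≤ 3 * a / ((2 / 3) * n (k + 1)) :=
      div_le_div_of_nonneg_left (by positivity) (by positivity) h1
    have e1 : 3 * a / ((2 / 3) * n (k + 1)) = 9 / 2 * (a / n (k + 1)) := by
      field_simp
      try norm_num
    have e2 : a / (2 * n (k + 1)) = 1 / 2 * (a / n (k + 1)) := by
      field_simp
    have e3 : 3 * a / n (k + 1) = 3 * (a / n (k + 1)) := by ring
    have hq : 0 < a / n (k + 1) := by positivity
    rw [e1] at h3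
    rw [e2] at h2
    rw [e3]
    linarith
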